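/- arXiv:1807.10244 — 5 statements merged into one kernel-verified Lean document; each statement's English description precedes it below -/
import Mathlib

section
/- Let P be a primitive stochastic matrix on a finite nonempty set X (there exists n ≥ 1 such that all entries of P^n are strictly positive), and let π be an invariant pmf for P (π P = π). Then the matrix I − P + 1⊗π is invertible, where 1⊗π denotes the matrix whose every row equals π; hence the fundamental matrix Z = (I − P + 1⊗π)^{-1} is well defined. -/
/-- A harmonic vector of a stochastic matrix with positive entries is constant. -/
theorem exists_eq_const_of_mulVec_eq_self {X : Type*} [Fintype X] [Nonempty X]
    {Q : Matrix X X ℝ} (hpos : ∀ x y, 0 < Q x y) (hone : Q.mulVec 1 = 1)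
    {v : X → ℝ} (hv : Q.mulVec v = v) : ∃ c : ℝ, v = fun _ => c := by
  obtain ⟨a, ha⟩ := Finite.exists_max v
  have hsum : ∑ y, Q a y * (v a - v y) = 0 := by
    have h1 : ∑ y, Q a y = 1 := by
      simpa [Matrix.mulVec, dotProduct] using congrFun hone a
    have h2 : ∑ y, Q a y * v y = v a := congrFun hv a
    simp only [mul_sub, Finset.sum_sub_distrib, ← Finset.sum_mul, h1, h2, one_mul, sub_self]
  refine ⟨v a, funext fun y => ?_⟩
  have hy := (Finset.sum_eq_zero_iff_of_nonneg fun z _ =>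
    mul_nonneg (hpos a z).le (sub_nonneg.2 (ha z))).1 hsum y (Finset.mem_univ y)
  exact (sub_eq_zero.1 ((mul_eq_zero.1 hy).resolve_left (hpos a y).ne')).symm

theorem pow_mulVec_eq_self {X R : Type*} [Fintype X] [DecidableEq X] [Semiring R]
    {P : Matrix X X R} {v : X → R} (h : P.mulVec v = v) (n : ℕ) : (P ^ n).mulVec v = v := by
  induction n with
  | zero => simp
  | succ n ih => rw [pow_succ, ← Matrix.mulVec_mulVec, h, ih]

/-- For a primitive stochastic matrix `P` with invariant pmf `π`,
the matrix `I − P + 1⊗π` is invertible (so the fundamental matrix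
`Z = (I − P + 1⊗π)⁻¹` is well defined). -/
theorem fundamental_matrix_exists
    {X : Type*} [Fintype X] [Nonempty X] [DecidableEq X]
    (P : Matrix X X ℝ)
    (hPnn : ∀ x x', 0 ≤ P x x') (hPsum : ∀ x, ∑ x', P x x' = 1)
    (hprim : ∃ n : ℕ, 1 ≤ n ∧ ∀ x x', 0 < (P ^ n) x x')
    (π : X → ℝ) (hπnn : ∀ x, 0 ≤ π x) (hπsum : ∑ x, π x = 1)
    (hπinv : ∀ x', ∑ x, π x * P x x' = π x') :
    IsUnit (1 - P + Matrix.of fun (_ : X) x' => π x') := by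
  obtain ⟨n, -, hn⟩ := hprim
  rw [Matrix.isUnit_iff_isUnit_det, isUnit_iff_ne_zero, ne_eq,
    ← Matrix.exists_mulVec_eq_zero_iff]
  rintro ⟨v, hv0, hv⟩
  have hrow : ∀ x, v x - P.mulVec v x + π ⬝ᵥ v = 0 := fun x => by
    have := congrFun hv x
    rw [Matrix.add_mulVec, Matrix.sub_mulVec, Matrix.one_mulVec] at this
    exact this
  have hπP : π ⬝ᵥ P.mulVec v = π ⬝ᵥ v := by
    rw [Matrix.dotProduct_mulVec]
    exact congrArg (· ⬝ᵥ v) (funext hπinv)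
  have hπv : π ⬝ᵥ v = 0 := by
    have h : ∑ x, π x * (v x - P.mulVec v x + π ⬝ᵥ v) = 0 := by simp [hrow]
    simp only [mul_add, mul_sub, Finset.sum_add_distrib, Finset.sum_sub_distrib,
      ← Finset.sum_mul, hπsum] at h
    change π ⬝ᵥ v - π ⬝ᵥ P.mulVec v + 1 * (π ⬝ᵥ v) = 0 at h
    linarith
  have hPv : P.mulVec v = v := funext fun x => by linarith [hrow x]
  have hP1 : P.mulVec 1 = 1 := funext fun x => by simp [Matrix.mulVec, dotProduct, hPsum]
  obtain ⟨c, rfl⟩ := exists_eq_const_of_mulVec_eq_self hn (pow_mulVec_eq_self hP1 n)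
    (pow_mulVec_eq_self hPv n)
  have hc : c = 0 := by simpa [dotProduct, ← Finset.sum_mul, hπsum] using hπv
  exact hv0 (funext fun _ => hc)
end

section
/- Let P be a primitive stochastic matrix on a finite nonempty set X with invariant pmf π, and let 1⊗π be the matrix whose every row equals π. Then (P − 1⊗π)^n = P^n − 1⊗π for every n ≥ 1, the series Σ_{n=0}^∞ (P − 1⊗π)^n converges (entrywise), and its sum equals the fundamental matrix Z = (I − P + 1⊗π)^{-1}, where by convention (P − 1⊗π)^0 = I. -/
/-- If the norms of the powers of `a ^ m` are summable for some `m ≠ 0`, then the geometric series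
of `a` is summable. -/
theorem summable_pow_of_summable_norm_pow_pow {R : Type*} [NormedRing R] [CompleteSpace R]
    (a : R) (m : ℕ) [NeZero m] (h : Summable fun k : ℕ => ‖(a ^ m) ^ k‖) :
    Summable fun n : ℕ => a ^ n := by
  have hfin : Summable fun i : Fin m => ‖a ^ (i : ℕ)‖ := (hasSum_fintype _).summable
  have hprod := summable_mul_of_summable_norm h hfin
  rw [← (Nat.divModEquiv m).summable_iff] at hprod
  refine hprod.congr fun n => ?_
  simp only [Function.comp_apply, Nat.divModEquiv_apply, ← pow_mul, ← pow_add, Fin.val_ofNat]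
  rw [Nat.div_add_mod]

section

attribute [local instance] Matrix.linftyOpNormedRing Matrix.linftyOpNormedAlgebra

/-- A nonnegative real matrix all of whose row sums are less than one has `ℓ∞` operator norm
less than one. -/
theorem Matrix.linfty_opNorm_lt_one_of_row_sum_lt_one {X : Type*} [Fintype X] [DecidableEq X]
    (R : Matrix X X ℝ) (hnn : ∀ x x', 0 ≤ R x x') (hsum : ∀ x, ∑ x', R x x' < 1) :
    ‖R‖ < 1 := by
  rw [Matrix.linfty_opNorm_def, NNReal.coe_lt_one, Finset.sup_lt_iff zero_lt_one]
  intro x _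
  rw [← NNReal.coe_lt_one, NNReal.coe_sum]
  simpa [abs_of_nonneg (hnn x _)] using hsum x

/-- If `Q` fixes an idempotent `W` on both sides and `Q - ε • W` is a strict contraction, then the
powers of `Q - W` are absolutely summable. -/
theorem summable_norm_pow_sub_of_norm_sub_smul_lt_one {A : Type*} [NormedRing A] [Algebra ℝ A]
    {Q W : A} (hQW : Q * W = W) (hWQ : W * Q = W) (hWW : W * W = W) {ε : ℝ}
    (hlt : ‖Q - ε • W‖ < 1) :
    Summable fun k : ℕ => ‖(Q - W) ^ k‖ := by
  set R := Q - ε • W with hR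
  have hleft : (1 - W) * R = Q - W := by
    simp only [hR, sub_mul, mul_sub, one_mul, mul_smul_comm, hWQ, hWW, sub_self, smul_zero,
      sub_zero]
  have hright : R * (1 - W) = Q - W := by
    simp only [hR, sub_mul, mul_sub, mul_one, smul_mul_assoc, hQW, hWW]; abel
  have hcomm : Commute (1 - W) R := hleft.trans hright.symm
  have hidem : IsIdempotentElem (1 - W) := IsIdempotentElem.one_sub hWW
  rw [← summable_nat_add_iff 1]
  have hgeom := (summable_nat_add_iff 1).2 (summable_norm_geometric_of_norm_lt_one hlt)
  refine Summable.of_nonneg_of_le (fun _ => norm_nonneg _) (fun k => ?_)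
    (hgeom.mul_left ‖1 - W‖)
  rw [← hleft, hcomm.mul_pow, hidem.pow_succ_eq]
  exact norm_mul_le _ _

theorem sub_pow_eq_pow_sub {A : Type*} [Ring A] {P W : A} (hPW : P * W = W) (hWP : W * P = W)
    (hWW : W * W = W) {n : ℕ} (hn : 1 ≤ n) : (P - W) ^ n = P ^ n - W := by
  have hpow (n : ℕ) : P ^ n * W = W := by
    induction n with
    | zero => simp
    | succ n ih => rw [pow_succ, mul_assoc, hPW, ih]
  induction n, hn using Nat.le_induction with
  | base => simp
  | succ n _ ih =>
    rw [pow_succ, ih, sub_mul, mul_sub, mul_sub, hWP, hWW, hpow, ← pow_succ, sub_self, sub_zero]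

/-- For a primitive stochastic matrix `P` with invariant pmf `π`
and `1⊗π` the matrix whose rows all equal `π`: `(P − 1⊗π)^n = P^n − 1⊗π` for
`n ≥ 1`, and the series `∑_{n≥0} (P − 1⊗π)^n` converges entrywise to the
fundamental matrix `Z = (I − P + 1⊗π)⁻¹` (with `(P − 1⊗π)^0 = I`). -/
theorem fundamental_matrix_series
    {X : Type*} [Fintype X] [Nonempty X] [DecidableEq X]
    (P : Matrix X X ℝ)
    (hPnn : ∀ x x', 0 ≤ P x x') (hPsum : ∀ x, ∑ x', P x x' = 1)
    (hprim : ∃ n : ℕ, 1 ≤ n ∧ ∀ x x', 0 < (P ^ n) x x')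
    (π : X → ℝ) (hπnn : ∀ x, 0 ≤ π x) (hπsum : ∑ x, π x = 1)
    (hπinv : ∀ x', ∑ x, π x * P x x' = π x') :
    let W : Matrix X X ℝ := Matrix.of fun (_ : X) x' => π x'
    (∀ n : ℕ, 1 ≤ n → (P - W) ^ n = P ^ n - W) ∧
    (∀ x x', HasSum (fun n : ℕ => ((P - W) ^ n) x x') (((1 - P + W)⁻¹) x x')) := by
  intro W
  have hP : P ∈ Matrix.rowStochastic ℝ X := Matrix.mem_rowStochastic_iff_sum.2 ⟨hPnn, hPsum⟩
  have hmulW {Q : Matrix X X ℝ} (hQ : Q ∈ Matrix.rowStochastic ℝ X) : Q * W = W := by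
    ext x x'
    simp [W, Matrix.mul_apply, ← Finset.sum_mul, Matrix.sum_row_of_mem_rowStochastic hQ]
  have hWP : W * P = W := by
    ext x x'
    simpa [W, Matrix.mul_apply] using hπinv x'
  have hWW : W * W = W :=
    hmulW (Matrix.mem_rowStochastic_iff_sum.2 ⟨fun _ => hπnn, fun _ => hπsum⟩)
  have hpow : ∀ n : ℕ, 1 ≤ n → (P - W) ^ n = P ^ n - W :=
    fun _ => sub_pow_eq_pow_sub (hmulW hP) hWP hWW
  refine ⟨hpow, ?_⟩
  obtain ⟨m, hm, hpos⟩ := hprim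
  have : NeZero m := ⟨by lia⟩
  have hQ : P ^ m ∈ Matrix.rowStochastic ℝ X := pow_mem hP m
  have hWQ : W * P ^ m = W := by
    have h : (W * (P - W)) * (P - W) ^ (m - 1) = 0 := by rw [mul_sub, hWP, hWW, sub_self, zero_mul]
    rw [mul_assoc, mul_pow_sub_one (by lia), hpow m hm, mul_sub, hWW, sub_eq_zero] at h
    exact h
  obtain ⟨p, hp⟩ := Finite.exists_min fun p : X × X => (P ^ m) p.1 p.2
  set ε := (P ^ m) p.1 p.2
  have hε : 0 < ε := hpos _ _
  have hlt : ‖P ^ m - ε • W‖ < 1 := by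
    refine Matrix.linfty_opNorm_lt_one_of_row_sum_lt_one _ (fun x x' => ?_) fun x => ?_
    · have hπle : π x' ≤ 1 :=
        hπsum ▸ Finset.single_le_sum (fun i _ => hπnn i) (Finset.mem_univ x')
      have hmin : ε ≤ (P ^ m) x x' := hp (x, x')
      simp only [W, Matrix.sub_apply, Matrix.smul_apply, Matrix.of_apply, smul_eq_mul]
      nlinarith
    · simp [W, ← Finset.mul_sum, hπsum, Matrix.sum_row_of_mem_rowStochastic hQ, hε]
  have hsummable : Summable fun n : ℕ => (P - W) ^ n := by
    have : CompleteSpace (Matrix X X ℝ) := FiniteDimensional.complete ℝ _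
    refine summable_pow_of_summable_norm_pow_pow _ m ?_
    rw [hpow m hm]
    exact summable_norm_pow_sub_of_norm_sub_smul_lt_one (hmulW hQ) hWQ hWW hlt
  have hinv : (1 - P + W)⁻¹ = ∑' n : ℕ, (P - W) ^ n := by
    refine Matrix.inv_eq_right_inv ?_
    rw [show 1 - P + W = 1 - (P - W) by abel]
    exact hsummable.one_sub_mul_tsum_pow
  rw [hinv]
  intro x x'
  exact Pi.hasSum.1 (Pi.hasSum.1 hsummable.hasSum x) x'

end
end

section
/- Let P be an irreducible stochastic matrix on a finite nonempty set X (for every x, x' there exists n ≥ 1 with (P^n)(x,x') > 0), let π be an invariant pmf for P, and let U : X → ℝ. If H and G both solve Poisson's equation P H = H − U + π(U) (entrywise, with π(U) = Σ_x π(x) U(x)), then H − G is a constant function. In particular, if additionally H(x°) = G(x°) = 0 for some fixed x° ∈ X, then H = G: the solution to Poisson's equation with this normalization is unique. -/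
namespace Matrix

variable {X : Type*} [Fintype X] [DecidableEq X]

theorem pow_mulVec_eq_self {P : Matrix X X ℝ} {f : X → ℝ} (hf : P *ᵥ f = f) (n : ℕ) :
    (P ^ n) *ᵥ f = f := by
  induction n with
  | zero => rw [pow_zero, one_mulVec]
  | succ n ih => rw [pow_succ, ← mulVec_mulVec, hf, ih]

/-- A harmonic function of an irreducible stochastic matrix is constant. -/
theorem exists_eq_const_of_mulVec_eq_self [Nonempty X] {P : Matrix X X ℝ}
    (hP : ∀ x y, 0 ≤ P x y) (hP_one : P *ᵥ 1 = 1)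
    (hirr : ∀ x y, ∃ n : ℕ, 0 < (P ^ n) x y)
    {f : X → ℝ} (hf : P *ᵥ f = f) : ∃ c : ℝ, ∀ x, f x = c := by
  obtain ⟨x, hx⟩ := Finite.exists_max f
  refine ⟨f x, fun y => ?_⟩
  obtain ⟨n, hn⟩ := hirr x y
  have hsum : ∑ z, (P ^ n) x z * (f x - f z) = 0 := by
    have h_one : ∑ z, (P ^ n) x z = 1 := by
      simpa [mulVec, dotProduct] using congrFun (pow_mulVec_eq_self hP_one n) x
    have h_f : ∑ z, (P ^ n) x z * f z = f x := congrFun (pow_mulVec_eq_self hf n) x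
    simp only [mul_sub, Finset.sum_sub_distrib, ← Finset.sum_mul, h_one, h_f, one_mul, sub_self]
  have hy := (Finset.sum_eq_zero_iff_of_nonneg fun z _ =>
    mul_nonneg (pow_apply_nonneg hP n x z) (sub_nonneg.2 (hx z))).1 hsum y (Finset.mem_univ y)
  exact (sub_eq_zero.1 ((mul_eq_zero.1 hy).resolve_left hn.ne')).symm

end Matrix

/-- For an irreducible stochastic matrix `P` with invariant pmf
`π`, any two solutions `H`, `G` of Poisson's equation
`P H = H − U + π(U)` differ by a constant; in particular, if
`H(x°) = G(x°) = 0` for some `x°`, then `H = G`. -/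
theorem poisson_equation_uniqueness
    {X : Type*} [Fintype X] [Nonempty X] [DecidableEq X]
    (P : Matrix X X ℝ)
    (hPnn : ∀ x x', 0 ≤ P x x') (hPsum : ∀ x, ∑ x', P x x' = 1)
    (hirr : ∀ x x', ∃ n : ℕ, 1 ≤ n ∧ 0 < (P ^ n) x x')
    (π : X → ℝ) (hπnn : ∀ x, 0 ≤ π x) (hπsum : ∑ x, π x = 1)
    (hπinv : ∀ x', ∑ x, π x * P x x' = π x')
    (U H G : X → ℝ)
    (hH : ∀ x, ∑ x', P x x' * H x' = H x - U x + ∑ y, π y * U y)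
    (hG : ∀ x, ∑ x', P x x' * G x' = G x - U x + ∑ y, π y * U y) :
    (∃ c : ℝ, ∀ x, H x - G x = c) ∧
    (∀ x₀ : X, H x₀ = 0 → G x₀ = 0 → H = G) := by
  obtain ⟨c, hc⟩ : ∃ c : ℝ, ∀ x, (H - G) x = c := by
    refine Matrix.exists_eq_const_of_mulVec_eq_self hPnn ?_
      (fun x y => (hirr x y).imp fun _ h => h.2) ?_
    · ext x
      simpa [Matrix.mulVec, dotProduct] using hPsum x
    · ext x
      rw [Matrix.mulVec_sub]
      change ∑ x', P x x' * H x' - ∑ x', P x x' * G x' = H x - G x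
      rw [hH, hG]
      ring
  refine ⟨⟨c, hc⟩, fun x₀ hH₀ hG₀ => ?_⟩
  ext x
  have h := (hc x).trans (hc x₀).symm
  simp only [Pi.sub_apply, hH₀, hG₀, sub_self] at h
  exact sub_eq_zero.1 h
end

section
/- Let X = X_u × X_n with nominal transition matrix P₀(x,(x_u',x_n')) = R₀(x,x_u') Q₀(x,x_n') and utility U : X → ℝ. For each ζ ∈ ℝ define the finite-horizon value functions recursively by W_{ζ,0}(x) = ζ U(x) and W_{ζ,τ}(x) = ζ U(x) + Λ_{W_{ζ,τ−1}}(x) for τ ≥ 1. Then for every τ ≥ 0 and every x ∈ X, the function ζ ↦ W_{ζ,τ}(x) is convex on ℝ. -/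
/-- Conditional average `h(xu'∣x) = ∑_{xn'} Q₀(x,xn') h(xu',xn')`. -/
noncomputable def condAvg {Xu Xn : Type*} [Fintype Xn]
    (Q₀ : (Xu × Xn) → Xn → ℝ) (h : Xu × Xn → ℝ) (x : Xu × Xn) (xu' : Xu) : ℝ :=
  ∑ xn', Q₀ x xn' * h (xu', xn')

/-- Log-partition function `Λ_h(x) = log ∑_{xu'} R₀(x,xu') exp(h(xu'∣x))`. -/
noncomputable def logPart {Xu Xn : Type*} [Fintype Xu] [Fintype Xn]
    (R₀ : (Xu × Xn) → Xu → ℝ) (Q₀ : (Xu × Xn) → Xn → ℝ)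
    (h : Xu × Xn → ℝ) (x : Xu × Xn) : ℝ :=
  Real.log (∑ xu', R₀ x xu' * Real.exp (condAvg Q₀ h x xu'))

/-- Finite-horizon value functions: `W_{ζ,0}(x) = ζU(x)` and
`W_{ζ,τ}(x) = ζU(x) + Λ_{W_{ζ,τ−1}}(x)` for `τ ≥ 1`. -/
noncomputable def valueFn {Xu Xn : Type*} [Fintype Xu] [Fintype Xn]
    (R₀ : (Xu × Xn) → Xu → ℝ) (Q₀ : (Xu × Xn) → Xn → ℝ)
    (U : Xu × Xn → ℝ) (ζ : ℝ) : ℕ → (Xu × Xn) → ℝ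
  | 0 => fun x => ζ * U x
  | τ + 1 => fun x => ζ * U x + logPart R₀ Q₀ (valueFn R₀ Q₀ U ζ τ) x

/-- The logarithm of a positive combination of exponentials of convex functions is convex. -/
theorem ConvexOn.log_sum_mul_exp {E ι : Type*} [AddCommMonoid E] [SMul ℝ E] [Fintype ι]
    [Nonempty ι] {s : Set E} (hs : Convex ℝ s) {r : ι → ℝ} (hr : ∀ i, 0 < r i)
    {f : ι → E → ℝ} (hf : ∀ i, ConvexOn ℝ s (f i)) :
    ConvexOn ℝ s (fun x => Real.log (∑ i, r i * Real.exp (f i x))) := by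
  have pos : ∀ x, 0 < ∑ i, r i * Real.exp (f i x) := fun x =>
    Finset.sum_pos (fun i _ => mul_pos (hr i) (Real.exp_pos _)) Finset.univ_nonempty
  have normalized : ∀ x,
      ∑ i, r i * Real.exp (f i x - Real.log (∑ j, r j * Real.exp (f j x))) = 1 := fun x => by
    simp_rw [Real.exp_sub, Real.exp_log (pos x), ← mul_div_assoc]
    rw [← Finset.sum_div, div_self (pos x).ne']
  refine ⟨hs, fun x hx y hy a b ha hb hab => ?_⟩
  set A := Real.log (∑ i, r i * Real.exp (f i x)) with hA
  set B := Real.log (∑ i, r i * Real.exp (f i y)) with hB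
  have bound : ∀ i, r i * Real.exp (f i (a • x + b • y)) ≤
      Real.exp (a * A + b * B) *
        (a * (r i * Real.exp (f i x - A)) + b * (r i * Real.exp (f i y - B))) := fun i => by
    have h₁ := (hf i).2 hx hy ha hb hab
    have h₂ := convexOn_exp.2 (Set.mem_univ (f i x - A)) (Set.mem_univ (f i y - B)) ha hb hab
    simp only [smul_eq_mul] at h₁ h₂
    calc r i * Real.exp (f i (a • x + b • y))
        ≤ r i * Real.exp ((a * A + b * B) + (a * (f i x - A) + b * (f i y - B))) := by
          refine mul_le_mul_of_nonneg_left (Real.exp_le_exp.2 ?_) (hr i).le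
          linarith
      _ = Real.exp (a * A + b * B) *
            (r i * Real.exp (a * (f i x - A) + b * (f i y - B))) := by
          rw [Real.exp_add]; ring
      _ ≤ Real.exp (a * A + b * B) *
            (r i * (a * Real.exp (f i x - A) + b * Real.exp (f i y - B))) :=
          mul_le_mul_of_nonneg_left (mul_le_mul_of_nonneg_left h₂ (hr i).le) (Real.exp_pos _).le
      _ = _ := by ring
  rw [smul_eq_mul, smul_eq_mul, Real.log_le_iff_le_exp (pos _)]
  refine (Finset.sum_le_sum fun i _ => bound i).trans_eq ?_
  rw [← Finset.mul_sum, Finset.sum_add_distrib, ← Finset.mul_sum, ← Finset.mul_sum,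
    normalized x, normalized y, mul_one, mul_one, hab, mul_one]

/-- A conditional average of convex functions is convex. -/
theorem convexOn_condAvg {Xu Xn E : Type*} [Fintype Xn] [AddCommMonoid E] [SMul ℝ E]
    {s : Set E} (hs : Convex ℝ s) {Q₀ : (Xu × Xn) → Xn → ℝ} (hQ₀ : ∀ x xn', 0 ≤ Q₀ x xn')
    {h : E → Xu × Xn → ℝ} (hh : ∀ x, ConvexOn ℝ s (fun ζ => h ζ x)) (x : Xu × Xn) (xu' : Xu) :
    ConvexOn ℝ s (fun ζ => condAvg Q₀ (h ζ) x xu') := by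
  refine ⟨hs, fun y hy z hz a b ha hb hab => ?_⟩
  simp only [condAvg, smul_eq_mul, Finset.mul_sum, ← Finset.sum_add_distrib]
  refine Finset.sum_le_sum fun xn' _ => ?_
  have key := mul_le_mul_of_nonneg_left ((hh (xu', xn')).2 hy hz ha hb hab) (hQ₀ x xn')
  simp only [smul_eq_mul] at key
  linarith

/-- For every horizon `τ` and state `x`, the finite-horizon value
`ζ ↦ W_{ζ,τ}(x)` is a convex function of `ζ` on `ℝ`. -/
theorem value_fn_convex_in_zeta
    {Xu Xn : Type*} [Fintype Xu] [Fintype Xn] [Nonempty Xu] [Nonempty Xn]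
    (R₀ : (Xu × Xn) → Xu → ℝ)
    (hR₀pos : ∀ x xu', 0 < R₀ x xu') (hR₀sum : ∀ x, ∑ xu', R₀ x xu' = 1)
    (Q₀ : (Xu × Xn) → Xn → ℝ)
    (hQ₀ : ∀ x xn', 0 ≤ Q₀ x xn') (hQ₀sum : ∀ x, ∑ xn', Q₀ x xn' = 1)
    (U : Xu × Xn → ℝ) :
    ∀ (τ : ℕ) (x : Xu × Xn),
      ConvexOn ℝ Set.univ (fun ζ : ℝ => valueFn R₀ Q₀ U ζ τ x) := by
  have linear : ∀ x, ConvexOn ℝ Set.univ (fun ζ : ℝ => ζ * U x) := fun x =>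
    (LinearMap.mulRight ℝ (U x)).convexOn convex_univ
  intro τ
  induction τ with
  | zero => exact linear
  | succ τ ih =>
    exact fun x => (linear x).add
      (ConvexOn.log_sum_mul_exp convex_univ (hR₀pos x) (convexOn_condAvg convex_univ hQ₀ ih x))
end

section
/- Let X = X_u × X_n with nominal transition matrix P₀(x,(x_u',x_n')) = R₀(x,x_u') Q₀(x,x_n') and utility U : X → ℝ. For each ζ ∈ ℝ define the finite-horizon value functions recursively by W_{ζ,0}(x) = ζ U(x) and W_{ζ,τ}(x) = ζ U(x) + Λ_{W_{ζ,τ−1}}(x) for τ ≥ 1. Then for every τ and every x, the map ζ ↦ W_{ζ,τ}(x) is differentiable, and the derivatives H_{ζ,τ}(x) := (d/dζ) W_{ζ,τ}(x) satisfy H_{ζ,0} = U and, for τ ≥ 1, H_{ζ,τ}(x) = U(x) + Σ_{x'} P_{W_{ζ,τ−1}}(x,x') H_{ζ,τ−1}(x'). Consequently, for τ ≥ 1, H_{ζ,τ} = ( I + P_{τ−1} + P_{τ−1}P_{τ−2} + ⋯ + P_{τ−1}P_{τ−2}⋯P_0 ) U, where P_i := P_{W_{ζ,i}} denotes the tilted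 transition matrix associated with W_{ζ,i}. -/
/-- Tilted matrix `P_h(x,(xu',xn')) = R₀(x,xu') exp(h(xu'∣x) − Λ_h(x)) Q₀(x,xn')`. -/
noncomputable def tilt {Xu Xn : Type*} [Fintype Xu] [Fintype Xn]
    (R₀ : (Xu × Xn) → Xu → ℝ) (Q₀ : (Xu × Xn) → Xn → ℝ)
    (h : Xu × Xn → ℝ) (x x' : Xu × Xn) : ℝ :=
  R₀ x x'.1 * Real.exp (condAvg Q₀ h x x'.1 - logPart R₀ Q₀ h x) * Q₀ x x'.2

/-- The recursion `H_{ζ,0} = U`,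
`H_{ζ,τ}(x) = U(x) + ∑_{x'} P_{W_{ζ,τ−1}}(x,x') H_{ζ,τ−1}(x')`. -/
noncomputable def derFn {Xu Xn : Type*} [Fintype Xu] [Fintype Xn]
    (R₀ : (Xu × Xn) → Xu → ℝ) (Q₀ : (Xu × Xn) → Xn → ℝ)
    (U : Xu × Xn → ℝ) (ζ : ℝ) : ℕ → (Xu × Xn) → ℝ
  | 0 => U
  | τ + 1 => fun x =>
      U x + ∑ x', tilt R₀ Q₀ (valueFn R₀ Q₀ U ζ τ) x x' * derFn R₀ Q₀ U ζ τ x'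

/-- The matrices `S_0 = I`, `S_τ = I + P_{τ−1} S_{τ−1}`, so that
`S_τ = I + P_{τ−1} + P_{τ−1}P_{τ−2} + ⋯ + P_{τ−1}⋯P_0`. -/
noncomputable def sumProd {Xu Xn : Type*} [Fintype Xu] [Fintype Xn]
    [DecidableEq Xu] [DecidableEq Xn]
    (R₀ : (Xu × Xn) → Xu → ℝ) (Q₀ : (Xu × Xn) → Xn → ℝ)
    (U : Xu × Xn → ℝ) (ζ : ℝ) : ℕ → (Xu × Xn) → (Xu × Xn) → ℝ
  | 0 => fun x x' => if x = x' then 1 else 0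
  | τ + 1 => fun x x' => (if x = x' then 1 else 0) +
      ∑ y, tilt R₀ Q₀ (valueFn R₀ Q₀ U ζ τ) x y * sumProd R₀ Q₀ U ζ τ y x'

lemma HasDerivAt.condAvg {Xu Xn : Type*} [Fintype Xn] {Q₀ : (Xu × Xn) → Xn → ℝ}
    {h : ℝ → Xu × Xn → ℝ} {h' : Xu × Xn → ℝ} {ζ : ℝ}
    (hh : ∀ x, HasDerivAt (fun ζ => h ζ x) (h' x) ζ) (x : Xu × Xn) (xu' : Xu) :
    HasDerivAt (fun ζ => condAvg Q₀ (h ζ) x xu') (condAvg Q₀ h' x xu') ζ :=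
  HasDerivAt.fun_sum fun xn' _ => (hh (xu', xn')).const_mul (Q₀ x xn')

section

variable {Xu Xn : Type*} [Fintype Xu] [Fintype Xn]
  {R₀ : (Xu × Xn) → Xu → ℝ} {Q₀ : (Xu × Xn) → Xn → ℝ}

lemma partition_pos [Nonempty Xu] (hR₀pos : ∀ x xu', 0 < R₀ x xu')
    (h : Xu × Xn → ℝ) (x : Xu × Xn) :
    0 < ∑ xu', R₀ x xu' * Real.exp (condAvg Q₀ h x xu') :=
  Finset.sum_pos (fun xu' _ => mul_pos (hR₀pos x xu') (Real.exp_pos _)) Finset.univ_nonempty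

lemma sum_tilt_mul [Nonempty Xu] (hR₀pos : ∀ x xu', 0 < R₀ x xu')
    (h g : Xu × Xn → ℝ) (x : Xu × Xn) :
    ∑ x', tilt R₀ Q₀ h x x' * g x' =
      (∑ xu', R₀ x xu' * (Real.exp (condAvg Q₀ h x xu') * condAvg Q₀ g x xu')) /
        ∑ xu', R₀ x xu' * Real.exp (condAvg Q₀ h x xu') := by
  rw [Fintype.sum_prod_type, Finset.sum_div]
  refine Finset.sum_congr rfl fun xu' _ => ?_
  simp only [tilt, logPart, Real.exp_sub, Real.exp_log (partition_pos hR₀pos h x)]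
  rw [condAvg.eq_def Q₀ g, Finset.mul_sum, Finset.mul_sum, Finset.sum_div]
  exact Finset.sum_congr rfl fun xn' _ => by ring

/-- The derivative of the log-partition function is the expectation under the tilted matrix. -/
lemma HasDerivAt.logPart [Nonempty Xu] (hR₀pos : ∀ x xu', 0 < R₀ x xu')
    {h : ℝ → Xu × Xn → ℝ} {h' : Xu × Xn → ℝ} {ζ : ℝ}
    (hh : ∀ x, HasDerivAt (fun ζ => h ζ x) (h' x) ζ) (x : Xu × Xn) :
    HasDerivAt (fun ζ => logPart R₀ Q₀ (h ζ) x) (∑ x', tilt R₀ Q₀ (h ζ) x x' * h' x') ζ := by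
  rw [sum_tilt_mul hR₀pos]
  exact HasDerivAt.log
    (HasDerivAt.fun_sum fun xu' _ => ((HasDerivAt.condAvg hh x xu').exp).const_mul (R₀ x xu'))
    (partition_pos hR₀pos (h ζ) x).ne'

lemma hasDerivAt_valueFn [Nonempty Xu] (hR₀pos : ∀ x xu', 0 < R₀ x xu')
    (U : Xu × Xn → ℝ) (ζ : ℝ) (τ : ℕ) (x : Xu × Xn) :
    HasDerivAt (fun ζ => valueFn R₀ Q₀ U ζ τ x) (derFn R₀ Q₀ U ζ τ x) ζ := by
  induction τ generalizing x with
  | zero => exact hasDerivAt_mul_const (U x)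
  | succ τ ih => exact (hasDerivAt_mul_const (U x)).add (HasDerivAt.logPart hR₀pos ih x)

lemma derFn_eq_sum_sumProd_mul [DecidableEq Xu] [DecidableEq Xn]
    (U : Xu × Xn → ℝ) (ζ : ℝ) (τ : ℕ) (x : Xu × Xn) :
    derFn R₀ Q₀ U ζ τ x = ∑ x', sumProd R₀ Q₀ U ζ τ x x' * U x' := by
  induction τ generalizing x with
  | zero => simp [derFn, sumProd]
  | succ τ ih =>
    simp only [derFn, sumProd, add_mul, Finset.sum_add_distrib, ite_mul, one_mul, zero_mul,
      Finset.sum_ite_eq, Finset.mem_univ, if_true, ih, Finset.mul_sum, Finset.sum_mul]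
    rw [Finset.sum_comm]
    simp only [mul_assoc]

end

/-- The maps `ζ ↦ W_{ζ,τ}(x)` are differentiable with
derivatives `H_{ζ,τ}` satisfying `H_{ζ,0} = U` and
`H_{ζ,τ}(x) = U(x) + ∑_{x'} P_{W_{ζ,τ−1}}(x,x') H_{ζ,τ−1}(x')` for `τ ≥ 1`;
consequently `H_{ζ,τ} = (I + P_{τ−1} + P_{τ−1}P_{τ−2} + ⋯ + P_{τ−1}⋯P_0) U`
for `τ ≥ 1`, where `P_i = P_{W_{ζ,i}}`. -/
theorem value_fn_derivative_recursion
    {Xu Xn : Type*} [Fintype Xu] [Fintype Xn] [Nonempty Xu] [Nonempty Xn]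
    [DecidableEq Xu] [DecidableEq Xn]
    (R₀ : (Xu × Xn) → Xu → ℝ)
    (hR₀pos : ∀ x xu', 0 < R₀ x xu') (hR₀sum : ∀ x, ∑ xu', R₀ x xu' = 1)
    (Q₀ : (Xu × Xn) → Xn → ℝ)
    (hQ₀ : ∀ x xn', 0 ≤ Q₀ x xn') (hQ₀sum : ∀ x, ∑ xn', Q₀ x xn' = 1)
    (U : Xu × Xn → ℝ) :
    -- differentiability, with derivative H_{ζ,τ}
    (∀ (ζ : ℝ) (τ : ℕ) (x : Xu × Xn),
      HasDerivAt (fun ζ : ℝ => valueFn R₀ Q₀ U ζ τ x) (derFn R₀ Q₀ U ζ τ x) ζ) ∧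
    -- the recursion satisfied by the derivatives
    (∀ ζ : ℝ, derFn R₀ Q₀ U ζ 0 = U) ∧
    (∀ (ζ : ℝ) (τ : ℕ) (x : Xu × Xn),
      derFn R₀ Q₀ U ζ (τ + 1) x
        = U x + ∑ x', tilt R₀ Q₀ (valueFn R₀ Q₀ U ζ τ) x x' * derFn R₀ Q₀ U ζ τ x') ∧
    -- the product representation for τ ≥ 1
    (∀ (ζ : ℝ) (τ : ℕ) (x : Xu × Xn),
      derFn R₀ Q₀ U ζ (τ + 1) x = ∑ x', sumProd R₀ Q₀ U ζ (τ + 1) x x' * U x') := by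
  exact ⟨hasDerivAt_valueFn hR₀pos U, fun _ => rfl, fun _ _ _ => rfl,
    fun ζ τ => derFn_eq_sum_sumProd_mul U ζ (τ + 1)⟩
end
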